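/- For the extended-model function V(·,·;σ₁,σ₂), for all x, y > 0 with y > (σ₂/σ₁)x one has V_x(x,y;σ₁,σ₂) − V_y(x,y;σ₁,σ₂) = (2(μ̄+δσ₂)/σ₁²)·exp(−2(μ̄+δσ₂)x/σ₁²)·Φ(((μ̄+δσ₂)y − (A+δσ₂)(σ₂/σ₁)x)/N) + (2(μ̄(σ₁−σ₂) − δσ₂(σ₁+σ₂))/(σ₁²(σ₁+σ₂)))·exp(−2μ̄y/(σ₁+σ₂)² − (2σ₂x/σ₁²)(μ̄σ₂/(σ₁+σ₂)² + δ))·Φ((By − C(σ₂/σ₁)x)/((σ₁+σ₂)N)), and this quantity is strictly positive; consequently {(x,y) ∈ (0,∞)² : V_x(x,y;σ₁,σ₂) > V_y(x,y;σ₁,σ₂)} = {(x,y) ∈ (0,∞)² : y > (σ₂/σ₁)x}, the reverse strict inequality holds exactly when y < (σ₂/σ₁)x, and equality holds exactly on the line y = (σ₂/σ₁)x. -/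

import Mathlib

open MeasureTheory Set Filter

noncomputable def Phi (z : ℝ) : ℝ :=
  (Real.sqrt (2 * Real.pi))⁻¹ * ∫ u in Set.Iio z, Real.exp (-(u ^ 2) / 2)

/-- The explicit formula for the value function of the extended model in the region
`y > (σ₂/σ₁) x`, with `N`, `A`, `B`, `C` as in the paper. -/
noncomputable def VformE (μ δ σ₁ σ₂ x y : ℝ) : ℝ :=
  Phi ((δ * σ₂ * x + (μ + δ * σ₂) * y)
      / Real.sqrt (σ₂ * (σ₁ * y - σ₂ * x) * (μ + δ * (σ₁ + σ₂))))
    - Real.exp (-(2 * μ * (x + y)) / (σ₁ + σ₂) ^ 2)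
      * Phi (((2 * μ + δ * (σ₁ + σ₂)) * σ₂ * x + ((μ + δ * σ₂) * (σ₁ + σ₂) - 2 * μ * σ₁) * y)
        / ((σ₁ + σ₂) * Real.sqrt (σ₂ * (σ₁ * y - σ₂ * x) * (μ + δ * (σ₁ + σ₂)))))
    - Real.exp (-(2 * (μ + δ * σ₂) * x) / σ₁ ^ 2)
      * Phi (((μ + δ * σ₂) * y - (2 * μ + δ * (σ₁ + σ₂) + δ * σ₂) * (σ₂ / σ₁) * x)
        / Real.sqrt (σ₂ * (σ₁ * y - σ₂ * x) * (μ + δ * (σ₁ + σ₂))))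
    + Real.exp (-(2 * μ * y) / (σ₁ + σ₂) ^ 2
          - 2 * σ₂ * x / σ₁ ^ 2 * (μ * σ₂ / (σ₁ + σ₂) ^ 2 + δ))
      * Phi ((((μ + δ * σ₂) * (σ₁ + σ₂) - 2 * μ * σ₁) * y
            - (δ * σ₁ ^ 2 + 3 * δ * σ₁ * σ₂ + 2 * (μ + δ * σ₂) * σ₂) * (σ₂ / σ₁) * x)
        / ((σ₁ + σ₂) * Real.sqrt (σ₂ * (σ₁ * y - σ₂ * x) * (μ + δ * (σ₁ + σ₂)))))

open Classical in
/-- The explicit value function of the extended model. -/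
noncomputable def Vext (μ δ σ₁ σ₂ x y : ℝ) : ℝ :=
  if σ₂ / σ₁ * x < y then VformE μ δ σ₁ σ₂ x y
  else if y < σ₂ / σ₁ * x then VformE μ δ σ₂ σ₁ y x
  else 1 - Real.exp (-(2 * μ * x) / (σ₁ * (σ₁ + σ₂)))

/-- Partial derivative of `Vext` in `x`. -/
noncomputable def VxE (μ δ σ₁ σ₂ x y : ℝ) : ℝ := deriv (fun x' => Vext μ δ σ₁ σ₂ x' y) x

/-- Partial derivative of `Vext` in `y`. -/
noncomputable def VyE (μ δ σ₁ σ₂ x y : ℝ) : ℝ := deriv (fun y' => Vext μ δ σ₁ σ₂ x y') y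

/-- Second partial derivative of `Vext` in `x`. -/
noncomputable def VxxE (μ δ σ₁ σ₂ x y : ℝ) : ℝ := deriv (fun x' => VxE μ δ σ₁ σ₂ x' y) x

/-- Second partial derivative of `Vext` in `y`. -/
noncomputable def VyyE (μ δ σ₁ σ₂ x y : ℝ) : ℝ := deriv (fun y' => VyE μ δ σ₁ σ₂ x y') y

/-- Mixed second partial derivative of `Vext`. -/
noncomputable def VxyE (μ δ σ₁ σ₂ x y : ℝ) : ℝ := deriv (fun y' => VxE μ δ σ₁ σ₂ x y') y

theorem gauss_int : Integrable (fun u : ℝ => Real.exp (-(u ^ 2) / 2)) := by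
  have := integrable_exp_neg_mul_sq (b := 1/2) (by norm_num)
  refine this.congr (ae_of_all _ fun u => ?_)
  simp only; congr 1; ring

theorem Phi_hasDerivAt (z : ℝ) :
    HasDerivAt Phi ((Real.sqrt (2 * Real.pi))⁻¹ * Real.exp (-(z ^ 2) / 2)) z := by
  have h : Phi = fun z => (Real.sqrt (2 * Real.pi))⁻¹ *
      ((∫ u in Set.Iic (0:ℝ), Real.exp (-(u ^ 2) / 2)) + ∫ u in (0:ℝ)..z, Real.exp (-(u ^ 2) / 2)) := by
    funext z
    rw [Phi, ← integral_Iic_eq_integral_Iio,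
      ← intervalIntegral.integral_Iic_sub_Iic gauss_int.integrableOn gauss_int.integrableOn]
    ring
  rw [h]
  refine HasDerivAt.const_mul _ (HasDerivAt.const_add _ ?_)
  have hc : Continuous (fun u : ℝ => Real.exp (-(u ^ 2) / 2)) := by fun_prop
  exact intervalIntegral.integral_hasDerivAt_right (hc.intervalIntegrable _ _)
    (hc.stronglyMeasurableAtFilter _ _) hc.continuousAt

theorem Phi_pos (z : ℝ) : 0 < Phi z := by
  unfold Phi
  refine mul_pos (by positivity) ?_
  rw [setIntegral_pos_iff_support_of_nonneg_ae (ae_of_all _ fun u => (Real.exp_pos _).le)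
    gauss_int.integrableOn]
  have : Function.support (fun u : ℝ => Real.exp (-(u ^ 2) / 2)) = univ := by
    ext u; simp [Real.exp_ne_zero]
  rw [this]; simp

theorem Phi_shift (a : ℝ) : Phi a = (Real.sqrt (2 * Real.pi))⁻¹ *
    ∫ u in Set.Iio (0:ℝ), Real.exp (-((u + a) ^ 2) / 2) := by
  unfold Phi
  congr 1
  have := (measurePreserving_add_right (volume : Measure ℝ) a).setIntegral_preimage_emb
    (measurableEmbedding_addRight a) (fun u : ℝ => Real.exp (-(u ^ 2) / 2)) (Set.Iio a)
  rw [← this]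
  congr 2
  ext u; simp

theorem Phi_total : (Real.sqrt (2 * Real.pi))⁻¹ * ∫ u : ℝ, Real.exp (-(u ^ 2) / 2) = 1 := by
  have h := integral_gaussian (1/2)
  have : (fun u : ℝ => Real.exp (-(u ^ 2) / 2)) = fun u => Real.exp (-(1/2) * u ^ 2) := by
    funext u; congr 1; ring
  rw [this, h]
  have e : Real.pi / (1/2) = 2 * Real.pi := by ring
  rw [e]
  exact inv_mul_cancel₀ (by positivity)

theorem Phi_neg (z : ℝ) : Phi (-z) = 1 - Phi z := by
  have h1 : ∫ u in Set.Iio (-z), Real.exp (-(u ^ 2) / 2)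
      = ∫ u in Set.Ici z, Real.exp (-(u ^ 2) / 2) := by
    have := integral_comp_neg_Iic (-z) (fun u : ℝ => Real.exp (-(u ^ 2) / 2))
    rw [← integral_Iic_eq_integral_Iio, integral_Ici_eq_integral_Ioi]
    simpa using this
  have h2 := integral_add_compl (measurableSet_Iio (a := z)) gauss_int
  rw [Set.compl_Iio] at h2
  have h3 := Phi_total
  rw [← h2] at h3
  unfold Phi
  rw [h1]
  linarith

theorem Phi_mills {a b : ℝ} (h : a ≤ b) :
    Real.exp (a ^ 2 / 2) * Phi a ≤ Real.exp (b ^ 2 / 2) * Phi b := by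
  rw [Phi_shift a, Phi_shift b, mul_left_comm, mul_left_comm (Real.exp (b ^ 2 / 2))]
  refine mul_le_mul_of_nonneg_left ?_ (by positivity)
  rw [← integral_const_mul, ← integral_const_mul]
  refine setIntegral_mono_on ((gauss_int.comp_add_right a).const_mul _).integrableOn
    ((gauss_int.comp_add_right b).const_mul _).integrableOn measurableSet_Iio ?_
  intro u hu
  rw [← Real.exp_add, ← Real.exp_add]
  apply Real.exp_le_exp.2
  have : u < 0 := hu
  nlinarith

theorem Phi_tail {z : ℝ} (hz : 0 < z) : Phi (-z) ≤ 8 / z ^ 4 := by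
  have h := Phi_mills (a := -z) (b := 0) (by linarith)
  have h0 : Phi 0 ≤ 1 := by
    have := Phi_neg 0
    have := Phi_pos (-0)
    linarith
  simp only [ne_eq, OfNat.ofNat_ne_zero, not_false_eq_true, zero_pow, zero_div, Real.exp_zero,
    one_mul, neg_sq] at h
  have h2 := Real.quadratic_le_exp_of_nonneg (x := z ^ 2 / 2) (by positivity)
  have h3 := Phi_pos (-z)
  rw [le_div_iff₀ (by positivity)]
  have h4 : z ^ 4 / 8 ≤ Real.exp (z ^ 2 / 2) := by nlinarith [sq_nonneg z]
  have := mul_le_mul_of_nonneg_right h4 h3.le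
  linarith

/-- Derivative along a curve; the density terms cancel. -/
theorem curve_deriv {a1 a2 a3 a4 E2 E3 E4 : ℝ → ℝ} {E2' E3' E4' t : ℝ}
    (h1 : DifferentiableAt ℝ a1 t) (h2 : DifferentiableAt ℝ a2 t) (h3 : DifferentiableAt ℝ a3 t)
    (h4 : ∀ t, a4 t = a2 t + a3 t - a1 t)
    (e2 : HasDerivAt E2 E2' t) (e3 : HasDerivAt E3 E3' t) (e4 : HasDerivAt E4 E4' t)
    (i2 : -(a1 t ^ 2) / 2 = E2 t + -(a2 t ^ 2) / 2)
    (i3 : -(a1 t ^ 2) / 2 = E3 t + -(a3 t ^ 2) / 2)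
    (i4 : -(a1 t ^ 2) / 2 = E4 t + -(a4 t ^ 2) / 2) :
    HasDerivAt (fun t => Phi (a1 t) - Real.exp (E2 t) * Phi (a2 t) - Real.exp (E3 t) * Phi (a3 t)
      + Real.exp (E4 t) * Phi (a4 t))
      (-(E2' * Real.exp (E2 t) * Phi (a2 t)) - E3' * Real.exp (E3 t) * Phi (a3 t)
        + E4' * Real.exp (E4 t) * Phi (a4 t)) t := by
  have g1 := h1.hasDerivAt
  have g2 := h2.hasDerivAt
  have g3 := h3.hasDerivAt
  have g4 : HasDerivAt a4 (deriv a2 t + deriv a3 t - deriv a1 t) t := by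
    have : a4 = fun t => a2 t + a3 t - a1 t := funext h4
    rw [this]
    exact (g2.add g3).sub g1
  have k1 := (Phi_hasDerivAt (a1 t)).comp t g1
  have k2 := (Phi_hasDerivAt (a2 t)).comp t g2
  have k3 := (Phi_hasDerivAt (a3 t)).comp t g3
  have k4 := (Phi_hasDerivAt (a4 t)).comp t g4
  have := ((k1.sub (e2.exp.mul k2)).sub (e3.exp.mul k3)).add (e4.exp.mul k4)
  refine this.congr_deriv ?_
  have j2 : Real.exp (-(a1 t ^ 2) / 2) = Real.exp (E2 t) * Real.exp (-(a2 t ^ 2) / 2) := by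
    rw [i2, Real.exp_add]
  have j3 : Real.exp (-(a1 t ^ 2) / 2) = Real.exp (E3 t) * Real.exp (-(a3 t ^ 2) / 2) := by
    rw [i3, Real.exp_add]
  have j4 : Real.exp (-(a1 t ^ 2) / 2) = Real.exp (E4 t) * Real.exp (-(a4 t ^ 2) / 2) := by
    rw [i4, Real.exp_add]
  set c := (Real.sqrt (2 * Real.pi))⁻¹
  simp only [Function.comp]
  linear_combination (c * deriv a2 t) * j2 + (c * deriv a3 t) * j3
    - (c * (deriv a2 t + deriv a3 t - deriv a1 t)) * j4

section alg
variable {μ δ σ₁ σ₂ x y N : ℝ}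

theorem ids (hσ₁ : 0 < σ₁) (hσ₂ : 0 < σ₂) (hN : 0 < N)
    (hN2 : N ^ 2 = σ₂ * (σ₁ * y - σ₂ * x) * (μ + δ * (σ₁ + σ₂))) :
    (-(((δ * σ₂ * x + (μ + δ * σ₂) * y) / N) ^ 2) / 2
      = -(2 * μ * (x + y)) / (σ₁ + σ₂) ^ 2 +
       -((((2 * μ + δ * (σ₁ + σ₂)) * σ₂ * x + ((μ + δ * σ₂) * (σ₁ + σ₂) - 2 * μ * σ₁) * y)
        / ((σ₁ + σ₂) * N)) ^ 2) / 2) ∧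
    (-(((δ * σ₂ * x + (μ + δ * σ₂) * y) / N) ^ 2) / 2
      = -(2 * (μ + δ * σ₂) * x) / σ₁ ^ 2 +
       -((((μ + δ * σ₂) * y - (2 * μ + δ * (σ₁ + σ₂) + δ * σ₂) * (σ₂ / σ₁) * x)
        / N) ^ 2) / 2) ∧
    (-(((δ * σ₂ * x + (μ + δ * σ₂) * y) / N) ^ 2) / 2
      = (-(2 * μ * y) / (σ₁ + σ₂) ^ 2
          - 2 * σ₂ * x / σ₁ ^ 2 * (μ * σ₂ / (σ₁ + σ₂) ^ 2 + δ)) +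
       -(((((μ + δ * σ₂) * (σ₁ + σ₂) - 2 * μ * σ₁) * y
            - (δ * σ₁ ^ 2 + 3 * δ * σ₁ * σ₂ + 2 * (μ + δ * σ₂) * σ₂) * (σ₂ / σ₁) * x)
        / ((σ₁ + σ₂) * N)) ^ 2) / 2) := by
  have hs : σ₁ + σ₂ ≠ 0 := by positivity
  have h0 : N ^ 2 ≠ 0 := by positivity
  rw [hN2] at h0
  obtain ⟨h1, hκ⟩ := mul_ne_zero_iff.1 h0
  obtain ⟨-, hd⟩ := mul_ne_zero_iff.1 h1
  simp only [div_pow, mul_pow, hN2]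
  clear hN2 h0 h1
  obtain ⟨d, rfl⟩ : ∃ d, y = (d + σ₂ * x) / σ₁ :=
    ⟨σ₁ * y - σ₂ * x, by field_simp; ring⟩
  have hdd : σ₁ * ((d + σ₂ * x) / σ₁) - σ₂ * x = d := by field_simp; ring
  rw [hdd] at hd ⊢
  refine ⟨?_, ?_, ?_⟩
  · field_simp
    ring
  · field_simp
    ring
  · field_simp
    ring

theorem lin_id (hσ₁ : 0 < σ₁) (hσ₂ : 0 < σ₂) :
   (((μ + δ * σ₂) * (σ₁ + σ₂) - 2 * μ * σ₁) * y
            - (δ * σ₁ ^ 2 + 3 * δ * σ₁ * σ₂ + 2 * (μ + δ * σ₂) * σ₂) * (σ₂ / σ₁) * x)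
        / ((σ₁ + σ₂) * N) =
    ((2 * μ + δ * (σ₁ + σ₂)) * σ₂ * x + ((μ + δ * σ₂) * (σ₁ + σ₂) - 2 * μ * σ₁) * y)
        / ((σ₁ + σ₂) * N) +
    ((μ + δ * σ₂) * y - (2 * μ + δ * (σ₁ + σ₂) + δ * σ₂) * (σ₂ / σ₁) * x) / N
    - (δ * σ₂ * x + (μ + δ * σ₂) * y) / N := by
  have hs : σ₁ + σ₂ ≠ 0 := by positivity
  rw [← div_div, ← div_div, ← add_div, ← sub_div]
  congr 1
  field_simp
  ring
end alg

theorem N_facts {μ δ σ₁ σ₂ x y : ℝ} (hσ₂ : 0 < σ₂) (hκ : 0 < μ + δ * (σ₁ + σ₂))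
    (hd : 0 < σ₁ * y - σ₂ * x) :
    0 < σ₂ * (σ₁ * y - σ₂ * x) * (μ + δ * (σ₁ + σ₂)) ∧
    0 < Real.sqrt (σ₂ * (σ₁ * y - σ₂ * x) * (μ + δ * (σ₁ + σ₂))) ∧
    Real.sqrt (σ₂ * (σ₁ * y - σ₂ * x) * (μ + δ * (σ₁ + σ₂))) ^ 2
      = σ₂ * (σ₁ * y - σ₂ * x) * (μ + δ * (σ₁ + σ₂)) := by
  have h : 0 < σ₂ * (σ₁ * y - σ₂ * x) * (μ + δ * (σ₁ + σ₂)) := by positivity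
  exact ⟨h, Real.sqrt_pos.2 h, Real.sq_sqrt h.le⟩

theorem Vform_x {μ δ σ₁ σ₂ x y : ℝ} (hσ₁ : 0 < σ₁) (hσ₂ : 0 < σ₂)
    (hκ : 0 < μ + δ * (σ₁ + σ₂)) (hd : 0 < σ₁ * y - σ₂ * x) :
    HasDerivAt (fun x => VformE μ δ σ₁ σ₂ x y)
      (-(-(2 * μ) / (σ₁ + σ₂) ^ 2 * Real.exp (-(2 * μ * (x + y)) / (σ₁ + σ₂) ^ 2)
      * Phi (((2 * μ + δ * (σ₁ + σ₂)) * σ₂ * x + ((μ + δ * σ₂) * (σ₁ + σ₂) - 2 * μ * σ₁) * y)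
        / ((σ₁ + σ₂) * Real.sqrt (σ₂ * (σ₁ * y - σ₂ * x) * (μ + δ * (σ₁ + σ₂))))))
    - -(2 * (μ + δ * σ₂)) / σ₁ ^ 2 * Real.exp (-(2 * (μ + δ * σ₂) * x) / σ₁ ^ 2)
      * Phi (((μ + δ * σ₂) * y - (2 * μ + δ * (σ₁ + σ₂) + δ * σ₂) * (σ₂ / σ₁) * x)
        / Real.sqrt (σ₂ * (σ₁ * y - σ₂ * x) * (μ + δ * (σ₁ + σ₂))))
    + -(2 * σ₂ / σ₁ ^ 2 * (μ * σ₂ / (σ₁ + σ₂) ^ 2 + δ)) * Real.exp (-(2 * μ * y) / (σ₁ + σ₂) ^ 2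
          - 2 * σ₂ * x / σ₁ ^ 2 * (μ * σ₂ / (σ₁ + σ₂) ^ 2 + δ))
      * Phi ((((μ + δ * σ₂) * (σ₁ + σ₂) - 2 * μ * σ₁) * y
            - (δ * σ₁ ^ 2 + 3 * δ * σ₁ * σ₂ + 2 * (μ + δ * σ₂) * σ₂) * (σ₂ / σ₁) * x)
        / ((σ₁ + σ₂) * Real.sqrt (σ₂ * (σ₁ * y - σ₂ * x) * (μ + δ * (σ₁ + σ₂)))))) x := by
  obtain ⟨h0, hN, hN2⟩ := N_facts hσ₂ hκ hd
  obtain ⟨i2, i3, i4⟩ := ids hσ₁ hσ₂ hN hN2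
  have hs : σ₁ + σ₂ ≠ 0 := by positivity
  have hsq : DifferentiableAt ℝ
      (fun x => Real.sqrt (σ₂ * (σ₁ * y - σ₂ * x) * (μ + δ * (σ₁ + σ₂)))) x :=
    DifferentiableAt.sqrt (by fun_prop) h0.ne'
  refine curve_deriv ?_ ?_ ?_ (fun t => lin_id hσ₁ hσ₂) ?_ ?_ ?_ i2 i3 i4
  · exact DifferentiableAt.div (by fun_prop) hsq hN.ne'
  · exact DifferentiableAt.div (by fun_prop) (hsq.const_mul _) (mul_ne_zero hs hN.ne')
  · exact DifferentiableAt.div (by fun_prop) hsq hN.ne'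
  · refine (((((hasDerivAt_id x).add_const y).const_mul (2 * μ)).neg).div_const _).congr_deriv ?_
    ring
  · refine ((((hasDerivAt_id x).const_mul (2 * (μ + δ * σ₂))).neg).div_const _).congr_deriv ?_
    ring
  · refine (((((hasDerivAt_id x).const_mul (2 * σ₂)).div_const _).mul_const _).const_sub _).congr_deriv ?_
    ring

theorem Vform_y {μ δ σ₁ σ₂ x y : ℝ} (hσ₁ : 0 < σ₁) (hσ₂ : 0 < σ₂)
    (hκ : 0 < μ + δ * (σ₁ + σ₂)) (hd : 0 < σ₁ * y - σ₂ * x) :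
    HasDerivAt (fun y => VformE μ δ σ₁ σ₂ x y)
      (-(-(2 * μ) / (σ₁ + σ₂) ^ 2 * Real.exp (-(2 * μ * (x + y)) / (σ₁ + σ₂) ^ 2)
      * Phi (((2 * μ + δ * (σ₁ + σ₂)) * σ₂ * x + ((μ + δ * σ₂) * (σ₁ + σ₂) - 2 * μ * σ₁) * y)
        / ((σ₁ + σ₂) * Real.sqrt (σ₂ * (σ₁ * y - σ₂ * x) * (μ + δ * (σ₁ + σ₂))))))
    - 0 * Real.exp (-(2 * (μ + δ * σ₂) * x) / σ₁ ^ 2)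
      * Phi (((μ + δ * σ₂) * y - (2 * μ + δ * (σ₁ + σ₂) + δ * σ₂) * (σ₂ / σ₁) * x)
        / Real.sqrt (σ₂ * (σ₁ * y - σ₂ * x) * (μ + δ * (σ₁ + σ₂))))
    + -(2 * μ) / (σ₁ + σ₂) ^ 2 * Real.exp (-(2 * μ * y) / (σ₁ + σ₂) ^ 2
          - 2 * σ₂ * x / σ₁ ^ 2 * (μ * σ₂ / (σ₁ + σ₂) ^ 2 + δ))
      * Phi ((((μ + δ * σ₂) * (σ₁ + σ₂) - 2 * μ * σ₁) * y
            - (δ * σ₁ ^ 2 + 3 * δ * σ₁ * σ₂ + 2 * (μ + δ * σ₂) * σ₂) * (σ₂ / σ₁) * x)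
        / ((σ₁ + σ₂) * Real.sqrt (σ₂ * (σ₁ * y - σ₂ * x) * (μ + δ * (σ₁ + σ₂)))))) y := by
  obtain ⟨h0, hN, hN2⟩ := N_facts hσ₂ hκ hd
  obtain ⟨i2, i3, i4⟩ := ids hσ₁ hσ₂ hN hN2
  have hs : σ₁ + σ₂ ≠ 0 := by positivity
  have hsq : DifferentiableAt ℝ
      (fun y => Real.sqrt (σ₂ * (σ₁ * y - σ₂ * x) * (μ + δ * (σ₁ + σ₂)))) y :=
    DifferentiableAt.sqrt (by fun_prop) h0.ne'
  refine curve_deriv (E3 := fun _ => -(2 * (μ + δ * σ₂) * x) / σ₁ ^ 2)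
    ?_ ?_ ?_ (fun t => lin_id hσ₁ hσ₂) ?_ ?_ ?_ i2 i3 i4
  · exact DifferentiableAt.div (by fun_prop) hsq hN.ne'
  · exact DifferentiableAt.div (by fun_prop) (hsq.const_mul _) (mul_ne_zero hs hN.ne')
  · exact DifferentiableAt.div (by fun_prop) hsq hN.ne'
  · refine (((((hasDerivAt_id y).const_add x).const_mul (2 * μ)).neg).div_const _).congr_deriv ?_
    ring
  · exact hasDerivAt_const _ _
  · refine (((((hasDerivAt_id y).const_mul (2 * μ)).neg).div_const _).sub_const _).congr_deriv ?_
    ring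

theorem line_iff {σ₁ σ₂ x y : ℝ} (hσ₁ : 0 < σ₁) :
    σ₂ / σ₁ * x < y ↔ 0 < σ₁ * y - σ₂ * x := by
  rw [div_mul_eq_mul_div, div_lt_iff₀ hσ₁, sub_pos, mul_comm y]

theorem line_iff' {σ₁ σ₂ x y : ℝ} (hσ₁ : 0 < σ₁) :
    y < σ₂ / σ₁ * x ↔ σ₁ * y - σ₂ * x < 0 := by
  rw [div_mul_eq_mul_div, lt_div_iff₀ hσ₁, sub_neg, mul_comm y]

theorem line_iff_eq {σ₁ σ₂ x y : ℝ} (hσ₁ : 0 < σ₁) :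
    y = σ₂ / σ₁ * x ↔ σ₁ * y - σ₂ * x = 0 := by
  rw [div_mul_eq_mul_div, eq_div_iff hσ₁.ne', sub_eq_zero, mul_comm y]

theorem Vext_swap {μ δ σ₁ σ₂ x y : ℝ} (hσ₁ : 0 < σ₁) (hσ₂ : 0 < σ₂) :
    Vext μ δ σ₁ σ₂ x y = Vext μ δ σ₂ σ₁ y x := by
  unfold Vext
  simp only [line_iff hσ₁, line_iff' hσ₁, line_iff hσ₂, line_iff' hσ₂]
  rcases lt_trichotomy (σ₁ * y - σ₂ * x) 0 with h | h | h
  · rw [if_neg (by linarith), if_pos h, if_pos (by linarith)]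
  · rw [if_neg (by linarith), if_neg (by linarith), if_neg (by linarith), if_neg (by linarith)]
    have : y = σ₂ / σ₁ * x := (line_iff_eq hσ₁).2 h
    subst this
    congr 2
    field_simp
    ring
  · rw [if_pos h, if_neg (by linarith), if_pos (by linarith)]

theorem VxE_swap {μ δ σ₁ σ₂ x y : ℝ} (hσ₁ : 0 < σ₁) (hσ₂ : 0 < σ₂) :
    VxE μ δ σ₁ σ₂ x y = VyE μ δ σ₂ σ₁ y x := by
  unfold VxE VyE
  congr 1; funext t; exact Vext_swap hσ₁ hσ₂

theorem VxE_eq {μ δ σ₁ σ₂ x y : ℝ} (hσ₁ : 0 < σ₁) (hd : 0 < σ₁ * y - σ₂ * x) :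
    VxE μ δ σ₁ σ₂ x y = deriv (fun x => VformE μ δ σ₁ σ₂ x y) x := by
  refine EventuallyEq.deriv_eq ?_
  have hc : Continuous (fun x => σ₁ * y - σ₂ * x) := by fun_prop
  filter_upwards [hc.continuousAt.eventually (lt_mem_nhds hd)] with t ht
  rw [Vext, if_pos ((line_iff hσ₁).2 ht)]

theorem VyE_eq {μ δ σ₁ σ₂ x y : ℝ} (hσ₁ : 0 < σ₁) (hd : 0 < σ₁ * y - σ₂ * x) :
    VyE μ δ σ₁ σ₂ x y = deriv (fun y => VformE μ δ σ₁ σ₂ x y) y := by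
  refine EventuallyEq.deriv_eq ?_
  have hc : Continuous (fun y => σ₁ * y - σ₂ * x) := by fun_prop
  filter_upwards [hc.continuousAt.eventually (lt_mem_nhds hd)] with t ht
  rw [Vext, if_pos ((line_iff hσ₁).2 ht)]

theorem main_pos {μ δ σ₁ σ₂ x y : ℝ} (hμ : 0 < μ) (hσ₁ : 0 < σ₁) (hσ₂ : 0 < σ₂)
    (hκ : 0 < μ + δ * (σ₁ + σ₂)) (hd : 0 < σ₁ * y - σ₂ * x) :
    VxE μ δ σ₁ σ₂ x y - VyE μ δ σ₁ σ₂ x y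
          = 2 * (μ + δ * σ₂) / σ₁ ^ 2 * Real.exp (-(2 * (μ + δ * σ₂) * x) / σ₁ ^ 2)
              * Phi (((μ + δ * σ₂) * y - (2 * μ + δ * (σ₁ + σ₂) + δ * σ₂) * (σ₂ / σ₁) * x)
                / Real.sqrt (σ₂ * (σ₁ * y - σ₂ * x) * (μ + δ * (σ₁ + σ₂))))
            + 2 * (μ * (σ₁ - σ₂) - δ * σ₂ * (σ₁ + σ₂)) / (σ₁ ^ 2 * (σ₁ + σ₂))
              * Real.exp (-(2 * μ * y) / (σ₁ + σ₂) ^ 2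
                  - 2 * σ₂ * x / σ₁ ^ 2 * (μ * σ₂ / (σ₁ + σ₂) ^ 2 + δ))
              * Phi ((((μ + δ * σ₂) * (σ₁ + σ₂) - 2 * μ * σ₁) * y
                    - (δ * σ₁ ^ 2 + 3 * δ * σ₁ * σ₂ + 2 * (μ + δ * σ₂) * σ₂) * (σ₂ / σ₁) * x)
                / ((σ₁ + σ₂) * Real.sqrt (σ₂ * (σ₁ * y - σ₂ * x) * (μ + δ * (σ₁ + σ₂)))))
        ∧ 0 < VxE μ δ σ₁ σ₂ x y - VyE μ δ σ₁ σ₂ x y := by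
  have key : ∀ P Q : Prop, P → (P → Q) → P ∧ Q := fun _ _ h1 h2 => ⟨h1, h2 h1⟩
  have hs : 0 < σ₁ + σ₂ := by positivity
  apply key
  · rw [VxE_eq hσ₁ hd, VyE_eq hσ₁ hd, (Vform_x hσ₁ hσ₂ hκ hd).deriv, (Vform_y hσ₁ hσ₂ hκ hd).deriv]
    have e : 2 * (μ * (σ₁ - σ₂) - δ * σ₂ * (σ₁ + σ₂)) / (σ₁ ^ 2 * (σ₁ + σ₂)) =
      -(2 * σ₂ / σ₁ ^ 2 * (μ * σ₂ / (σ₁ + σ₂) ^ 2 + δ)) - -(2 * μ) / (σ₁ + σ₂) ^ 2 := by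
      field_simp
      ring
    rw [e]
    ring
  · intro e
    rw [e]
    obtain ⟨h0, hN, hN2⟩ := N_facts hσ₂ hκ hd
    obtain ⟨i2, i3, i4⟩ := ids hσ₁ hσ₂ hN hN2
    set N := Real.sqrt (σ₂ * (σ₁ * y - σ₂ * x) * (μ + δ * (σ₁ + σ₂)))
    clear_value N
    have hle : (((μ + δ * σ₂) * (σ₁ + σ₂) - 2 * μ * σ₁) * y
                    - (δ * σ₁ ^ 2 + 3 * δ * σ₁ * σ₂ + 2 * (μ + δ * σ₂) * σ₂) * (σ₂ / σ₁) * x)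
                / ((σ₁ + σ₂) * N) ≤
        ((μ + δ * σ₂) * y - (2 * μ + δ * (σ₁ + σ₂) + δ * σ₂) * (σ₂ / σ₁) * x) / N := by
      have e2 : ((μ + δ * σ₂) * y - (2 * μ + δ * (σ₁ + σ₂) + δ * σ₂) * (σ₂ / σ₁) * x) / N
         - (((μ + δ * σ₂) * (σ₁ + σ₂) - 2 * μ * σ₁) * y
                    - (δ * σ₁ ^ 2 + 3 * δ * σ₁ * σ₂ + 2 * (μ + δ * σ₂) * σ₂) * (σ₂ / σ₁) * x)
                / ((σ₁ + σ₂) * N) = 2 * μ * (σ₁ * y - σ₂ * x) / ((σ₁ + σ₂) * N) := by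
        field_simp
        ring
      have : 0 ≤ 2 * μ * (σ₁ * y - σ₂ * x) / ((σ₁ + σ₂) * N) := by positivity
      linarith
    set a3 := ((μ + δ * σ₂) * y - (2 * μ + δ * (σ₁ + σ₂) + δ * σ₂) * (σ₂ / σ₁) * x) / N
    set a4 := (((μ + δ * σ₂) * (σ₁ + σ₂) - 2 * μ * σ₁) * y
                    - (δ * σ₁ ^ 2 + 3 * δ * σ₁ * σ₂ + 2 * (μ + δ * σ₂) * σ₂) * (σ₂ / σ₁) * x)
                / ((σ₁ + σ₂) * N)
    set a1 := (δ * σ₂ * x + (μ + δ * σ₂) * y) / N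
    set E3 := -(2 * (μ + δ * σ₂) * x) / σ₁ ^ 2
    set E4 := (-(2 * μ * y) / (σ₁ + σ₂) ^ 2
          - 2 * σ₂ * x / σ₁ ^ 2 * (μ * σ₂ / (σ₁ + σ₂) ^ 2 + δ))
    have hm := Phi_mills hle
    have hm' := mul_le_mul_of_nonneg_left hm (Real.exp_pos (-(a1 ^ 2) / 2)).le
    rw [← mul_assoc, ← mul_assoc, ← Real.exp_add, ← Real.exp_add] at hm'
    rw [show -(a1 ^ 2) / 2 + a4 ^ 2 / 2 = E4 by linarith,
      show -(a1 ^ 2) / 2 + a3 ^ 2 / 2 = E3 by linarith] at hm'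
    have p4 : 0 < Real.exp E4 * Phi a4 := mul_pos (Real.exp_pos _) (Phi_pos _)
    have hmm : 0 < μ + δ * σ₂ := by
      have : 0 < (μ + δ * σ₂) * (σ₁ + σ₂) := by nlinarith [mul_pos hμ hσ₁, mul_pos hκ hσ₂]
      exact pos_of_mul_pos_left this hs.le
    have c : 2 * (μ + δ * σ₂) / σ₁ ^ 2 +
       2 * (μ * (σ₁ - σ₂) - δ * σ₂ * (σ₁ + σ₂)) / (σ₁ ^ 2 * (σ₁ + σ₂)) = 4 * μ / (σ₁ * (σ₁ + σ₂)) := by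
      field_simp
      ring
    have c' : 0 < 4 * μ / (σ₁ * (σ₁ + σ₂)) := by positivity
    have c2 : 0 < 2 * (μ + δ * σ₂) / σ₁ ^ 2 := by positivity
    set q := 2 * (μ * (σ₁ - σ₂) - δ * σ₂ * (σ₁ + σ₂)) / (σ₁ ^ 2 * (σ₁ + σ₂))
    set p := 2 * (μ + δ * σ₂) / σ₁ ^ 2
    have := mul_le_mul_of_nonneg_left hm' c2.le
    have : 0 < (p + q) * (Real.exp E4 * Phi a4) := mul_pos (by linarith) p4
    linarith

theorem tail_bigO {g n d : ℝ × ℝ → ℝ} {p₀ : ℝ × ℝ} {c : ℝ} (hc : 0 < c)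
    (hg : ContinuousAt g p₀) (hn : ContinuousAt n p₀) (hn0 : 0 < n p₀) :
    (fun p => g p * Phi (-(n p / Real.sqrt (c * d p))))
      =O[nhds p₀ ⊓ 𝓟 {p | 0 < d p}] fun p => d p ^ 2 := by
  refine Asymptotics.IsBigO.of_bound ((|g p₀| + 1) * (8 * c ^ 2 / (n p₀ / 2) ^ 4)) ?_
  rw [eventually_inf_principal]
  have e1 : ∀ᶠ p in nhds p₀, |g p| < |g p₀| + 1 :=
    hg.abs.eventually (gt_mem_nhds (lt_add_one _))
  have e2 : ∀ᶠ p in nhds p₀, n p₀ / 2 < n p := hn.eventually (lt_mem_nhds (half_lt_self hn0))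
  filter_upwards [e1, e2] with p h1 h2 hd
  have hd : 0 < d p := hd
  have hnp : 0 < n p := by linarith
  have hN : 0 < Real.sqrt (c * d p) := Real.sqrt_pos.2 (by positivity)
  have hN2 : Real.sqrt (c * d p) ^ 2 = c * d p := Real.sq_sqrt (by positivity)
  have ht := Phi_tail (div_pos hnp hN)
  have hp := Phi_pos (-(n p / Real.sqrt (c * d p)))
  rw [norm_mul, Real.norm_eq_abs, Real.norm_eq_abs, Real.norm_eq_abs, abs_of_pos hp,
    abs_of_nonneg (sq_nonneg (d p)), mul_assoc]
  have h3 : 8 / (n p / Real.sqrt (c * d p)) ^ 4 = 8 * c ^ 2 / (n p) ^ 4 * d p ^ 2 := by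
    have : Real.sqrt (c * d p) ^ 4 = c ^ 2 * d p ^ 2 := by
      rw [show (4:ℕ) = 2 * 2 by norm_num, pow_mul, hN2]; ring
    rw [div_pow, this]
    field_simp
  have h4 : 8 * c ^ 2 / (n p) ^ 4 ≤ 8 * c ^ 2 / (n p₀ / 2) ^ 4 := by gcongr
  have h5 : Phi (-(n p / Real.sqrt (c * d p))) ≤ 8 * c ^ 2 / (n p₀ / 2) ^ 4 * d p ^ 2 := by
    rw [h3] at ht
    exact ht.trans (mul_le_mul_of_nonneg_right h4 (sq_nonneg _))
  exact mul_le_mul h1.le h5 hp.le (by positivity)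

/-- The smooth function that `Vext` agrees with to second order along the line. -/
noncomputable def Fl (μ s : ℝ) (p : ℝ × ℝ) : ℝ := 1 - Real.exp (-(2 * μ * (p.1 + p.2)) / s ^ 2)

theorem Vform_bigO {μ δ σ₁ σ₂ x y : ℝ} (hσ₁ : 0 < σ₁) (hσ₂ : 0 < σ₂)
    (hκ : 0 < μ + δ * (σ₁ + σ₂)) (hx : 0 < x) (hd : σ₁ * y - σ₂ * x = 0) :
    (fun p : ℝ × ℝ => VformE μ δ σ₁ σ₂ p.1 p.2 - Fl μ (σ₁ + σ₂) p)
      =O[nhds (x, y) ⊓ 𝓟 {p : ℝ × ℝ | 0 < σ₁ * p.2 - σ₂ * p.1}]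
        fun p => (σ₁ * p.2 - σ₂ * p.1) ^ 2 := by
  have hs : 0 < σ₁ + σ₂ := by positivity
  obtain rfl : y = σ₂ / σ₁ * x := (line_iff_eq hσ₁).2 hd
  have hpos : 0 < (μ + δ * (σ₁ + σ₂)) * (σ₂ / σ₁ * x) := by positivity
  have hc : 0 < σ₂ * (μ + δ * (σ₁ + σ₂)) := by positivity
  have t1 := tail_bigO (d := fun p : ℝ × ℝ => σ₁ * p.2 - σ₂ * p.1) (p₀ := (x, σ₂ / σ₁ * x)) hc
    (g := fun _ => 1) (n := fun p => δ * σ₂ * p.1 + (μ + δ * σ₂) * p.2)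
    (by fun_prop) (by fun_prop) (by
      simp only
      convert hpos using 1
      field_simp
      ring)
  have t2 := tail_bigO (d := fun p : ℝ × ℝ => σ₁ * p.2 - σ₂ * p.1) (p₀ := (x, σ₂ / σ₁ * x)) hc
    (g := fun p => Real.exp (-(2 * μ * (p.1 + p.2)) / (σ₁ + σ₂) ^ 2))
    (n := fun p => ((2 * μ + δ * (σ₁ + σ₂)) * σ₂ * p.1
      + ((μ + δ * σ₂) * (σ₁ + σ₂) - 2 * μ * σ₁) * p.2) / (σ₁ + σ₂))
    (by fun_prop) (by fun_prop) (by
      simp only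
      convert hpos using 1
      field_simp
      ring)
  have t3 := tail_bigO (d := fun p : ℝ × ℝ => σ₁ * p.2 - σ₂ * p.1) (p₀ := (x, σ₂ / σ₁ * x)) hc
    (g := fun p => Real.exp (-(2 * (μ + δ * σ₂) * p.1) / σ₁ ^ 2))
    (n := fun p => -((μ + δ * σ₂) * p.2 - (2 * μ + δ * (σ₁ + σ₂) + δ * σ₂) * (σ₂ / σ₁) * p.1))
    (by fun_prop) (by fun_prop) (by
      simp only
      convert hpos using 1
      field_simp
      ring)
  have t4 := tail_bigO (d := fun p : ℝ × ℝ => σ₁ * p.2 - σ₂ * p.1) (p₀ := (x, σ₂ / σ₁ * x)) hc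
    (g := fun p => Real.exp (-(2 * μ * p.2) / (σ₁ + σ₂) ^ 2
          - 2 * σ₂ * p.1 / σ₁ ^ 2 * (μ * σ₂ / (σ₁ + σ₂) ^ 2 + δ)))
    (n := fun p => -((((μ + δ * σ₂) * (σ₁ + σ₂) - 2 * μ * σ₁) * p.2
            - (δ * σ₁ ^ 2 + 3 * δ * σ₁ * σ₂ + 2 * (μ + δ * σ₂) * σ₂) * (σ₂ / σ₁) * p.1)
            / (σ₁ + σ₂)))
    (by fun_prop) (by fun_prop) (by
      simp only
      convert hpos using 1
      field_simp
      ring)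
  refine (((t2.sub t1).sub t3).add t4).congr_left fun p => ?_
  simp only [VformE, Fl]
  rw [← div_div, ← div_div]
  rw [show σ₂ * (σ₁ * p.2 - σ₂ * p.1) * (μ + δ * (σ₁ + σ₂))
    = σ₂ * (μ + δ * (σ₁ + σ₂)) * (σ₁ * p.2 - σ₂ * p.1) by ring]
  simp only [Phi_neg, neg_div, neg_neg]
  ring

theorem Vext_bigO {μ δ σ₁ σ₂ x y : ℝ} (hσ₁ : 0 < σ₁) (hσ₂ : 0 < σ₂)
    (hκ : 0 < μ + δ * (σ₁ + σ₂)) (hx : 0 < x) (hy : 0 < y) (hd : σ₁ * y - σ₂ * x = 0) :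
    (fun p : ℝ × ℝ => Vext μ δ σ₁ σ₂ p.1 p.2 - Fl μ (σ₁ + σ₂) p)
      =O[nhds (x, y)] fun p => (σ₁ * p.2 - σ₂ * p.1) ^ 2 := by
  have h1 := Vform_bigO hσ₁ hσ₂ hκ hx hd
  have h2 := (Vform_bigO (μ := μ) (δ := δ) (x := y) (y := x) hσ₂ hσ₁
    (by rwa [add_comm σ₂]) hy (by linarith))
  obtain ⟨K1, h1⟩ := h1.bound
  obtain ⟨K2, h2⟩ := h2.bound
  rw [eventually_inf_principal] at h1 h2
  have h2' := (continuous_swap.tendsto (x, y)).eventually h2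
  refine Asymptotics.IsBigO.of_bound (max K1 K2) ?_
  filter_upwards [h1, h2'] with p g1 g2
  rcases lt_trichotomy (σ₁ * p.2 - σ₂ * p.1) 0 with h | h | h
  · rw [Vext, if_neg (by rw [line_iff hσ₁]; linarith), if_pos ((line_iff' hσ₁).2 h)]
    have g := g2 (by simp only [Prod.fst_swap, Prod.snd_swap]; linarith)
    simp only [Prod.fst_swap, Prod.snd_swap] at g
    have e1 : Fl μ (σ₂ + σ₁) p.swap = Fl μ (σ₁ + σ₂) p := by
      simp only [Fl, Prod.fst_swap, Prod.snd_swap, add_comm]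
    have e2 : (σ₂ * p.1 - σ₁ * p.2) ^ 2 = (σ₁ * p.2 - σ₂ * p.1) ^ 2 := by ring
    rw [e1, e2] at g
    exact g.trans (mul_le_mul_of_nonneg_right (le_max_right _ _) (norm_nonneg _))
  · rw [Vext, if_neg (by rw [line_iff hσ₁]; linarith), if_neg (by rw [line_iff' hσ₁]; linarith), h]
    have e : p.2 = σ₂ / σ₁ * p.1 := (line_iff_eq hσ₁).2 h
    have : Fl μ (σ₁ + σ₂) p = 1 - Real.exp (-(2 * μ * p.1) / (σ₁ * (σ₁ + σ₂))) := by
      rw [Fl, e]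
      congr 2
      field_simp
    rw [this]
    simp
  · rw [Vext, if_pos ((line_iff hσ₁).2 h)]
    exact (g1 h).trans (mul_le_mul_of_nonneg_right (le_max_left _ _) (norm_nonneg _))

theorem deriv_line {f F : ℝ → ℝ} {F' t c : ℝ} (hF : HasDerivAt F F' t)
    (h : (fun u => f u - F u) =O[nhds t] fun u => (c * (u - t)) ^ 2) :
    HasDerivAt f F' t := by
  have hz : f t - F t = 0 := by
    have := h.eq_zero_imp.self_of_nhds
    exact this (by simp)
  have h0 : HasDerivAt (fun u => f u - F u) 0 t := by
    rw [hasDerivAt_iff_isLittleO]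
    simp only [hz, smul_zero, sub_zero]
    refine h.trans_isLittleO ?_
    have : (fun u => (c * (u - t)) ^ 2) = fun u => c ^ 2 * (u - t) ^ 2 := by funext u; ring
    rw [this]
    refine Asymptotics.IsLittleO.const_mul_left ?_ _
    simpa [sq_abs] using Asymptotics.isLittleO_pow_sub_sub t (m := 2) (by norm_num)
  have := h0.add hF
  refine (this.congr_deriv (zero_add _)).congr_of_eventuallyEq (Eventually.of_forall fun u => ?_)
  simp

theorem line_eq {μ δ σ₁ σ₂ x y : ℝ} (hσ₁ : 0 < σ₁) (hσ₂ : 0 < σ₂)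
    (hκ : 0 < μ + δ * (σ₁ + σ₂)) (hx : 0 < x) (hy : 0 < y) (hd : σ₁ * y - σ₂ * x = 0) :
    VxE μ δ σ₁ σ₂ x y = VyE μ δ σ₁ σ₂ x y := by
  have h := Vext_bigO (μ := μ) (δ := δ) hσ₁ hσ₂ hκ hx hy hd
  have hx' : Tendsto (fun u : ℝ => (u, y)) (nhds x) (nhds (x, y)) :=
    (Continuous.prodMk_left y).tendsto x
  have hy' : Tendsto (fun u : ℝ => (x, u)) (nhds y) (nhds (x, y)) :=
    (Continuous.prodMk_right x).tendsto y
  have dF : HasDerivAt (fun u => 1 - Real.exp (-(2 * μ * u) / (σ₁ + σ₂) ^ 2))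
      (deriv (fun u => 1 - Real.exp (-(2 * μ * u) / (σ₁ + σ₂) ^ 2)) (x + y)) (x + y) :=
    DifferentiableAt.hasDerivAt (by fun_prop)
  have dx := deriv_line (f := fun u => Vext μ δ σ₁ σ₂ u y) (c := σ₂) (dF.comp_add_const x y)
    ((h.comp_tendsto hx').congr_right fun u => by
      simp only [Function.comp]; rw [show σ₁ * y = σ₂ * x by linarith]; ring)
  have dy := deriv_line (f := fun u => Vext μ δ σ₁ σ₂ x u) (c := σ₁) (dF.comp_const_add x y)
    ((h.comp_tendsto hy').congr_right fun u => by
      simp only [Function.comp]; rw [show σ₂ * x = σ₁ * y by linarith]; ring)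
  rw [VxE, VyE, dx.deriv, dy.deriv]

theorem stmt19 (μ δ σ₁ σ₂ : ℝ) (hμ : 0 < μ) (hσ₁ : 0 < σ₁) (hσ₂ : 0 < σ₂)
    (hδ : -(μ / (σ₁ + σ₂)) < δ) :
    (∀ x y : ℝ, 0 < x → 0 < y → σ₂ / σ₁ * x < y →
        VxE μ δ σ₁ σ₂ x y - VyE μ δ σ₁ σ₂ x y
          = 2 * (μ + δ * σ₂) / σ₁ ^ 2 * Real.exp (-(2 * (μ + δ * σ₂) * x) / σ₁ ^ 2)
              * Phi (((μ + δ * σ₂) * y - (2 * μ + δ * (σ₁ + σ₂) + δ * σ₂) * (σ₂ / σ₁) * x)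
                / Real.sqrt (σ₂ * (σ₁ * y - σ₂ * x) * (μ + δ * (σ₁ + σ₂))))
            + 2 * (μ * (σ₁ - σ₂) - δ * σ₂ * (σ₁ + σ₂)) / (σ₁ ^ 2 * (σ₁ + σ₂))
              * Real.exp (-(2 * μ * y) / (σ₁ + σ₂) ^ 2
                  - 2 * σ₂ * x / σ₁ ^ 2 * (μ * σ₂ / (σ₁ + σ₂) ^ 2 + δ))
              * Phi ((((μ + δ * σ₂) * (σ₁ + σ₂) - 2 * μ * σ₁) * y
                    - (δ * σ₁ ^ 2 + 3 * δ * σ₁ * σ₂ + 2 * (μ + δ * σ₂) * σ₂) * (σ₂ / σ₁) * x)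
                / ((σ₁ + σ₂) * Real.sqrt (σ₂ * (σ₁ * y - σ₂ * x) * (μ + δ * (σ₁ + σ₂)))))
        ∧ 0 < VxE μ δ σ₁ σ₂ x y - VyE μ δ σ₁ σ₂ x y)
    ∧ {p : ℝ × ℝ | p ∈ Set.Ioi (0 : ℝ) ×ˢ Set.Ioi (0 : ℝ)
          ∧ VyE μ δ σ₁ σ₂ p.1 p.2 < VxE μ δ σ₁ σ₂ p.1 p.2}
        = {p : ℝ × ℝ | p ∈ Set.Ioi (0 : ℝ) ×ˢ Set.Ioi (0 : ℝ) ∧ σ₂ / σ₁ * p.1 < p.2}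
    ∧ {p : ℝ × ℝ | p ∈ Set.Ioi (0 : ℝ) ×ˢ Set.Ioi (0 : ℝ)
          ∧ VxE μ δ σ₁ σ₂ p.1 p.2 < VyE μ δ σ₁ σ₂ p.1 p.2}
        = {p : ℝ × ℝ | p ∈ Set.Ioi (0 : ℝ) ×ˢ Set.Ioi (0 : ℝ) ∧ p.2 < σ₂ / σ₁ * p.1}
    ∧ {p : ℝ × ℝ | p ∈ Set.Ioi (0 : ℝ) ×ˢ Set.Ioi (0 : ℝ)
          ∧ VxE μ δ σ₁ σ₂ p.1 p.2 = VyE μ δ σ₁ σ₂ p.1 p.2}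
        = {p : ℝ × ℝ | p ∈ Set.Ioi (0 : ℝ) ×ˢ Set.Ioi (0 : ℝ) ∧ p.2 = σ₂ / σ₁ * p.1} := by
  have hs : 0 < σ₁ + σ₂ := by positivity
  have hκ : 0 < μ + δ * (σ₁ + σ₂) := by
    rw [← neg_div, div_lt_iff₀ hs] at hδ
    linarith
  have up : ∀ x y : ℝ, 0 < σ₁ * y - σ₂ * x → VyE μ δ σ₁ σ₂ x y < VxE μ δ σ₁ σ₂ x y :=
    fun x y h => sub_pos.1 (main_pos hμ hσ₁ hσ₂ hκ h).2
  have lo : ∀ x y : ℝ, σ₁ * y - σ₂ * x < 0 → VxE μ δ σ₁ σ₂ x y < VyE μ δ σ₁ σ₂ x y := by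
    intro x y h
    have := (main_pos (x := y) (y := x) (μ := μ) (δ := δ) hμ hσ₂ hσ₁ (by rwa [add_comm σ₂])
      (by linarith)).2
    rw [VxE_swap hσ₁ hσ₂, ← VxE_swap hσ₂ hσ₁]
    linarith
  have eq : ∀ x y : ℝ, 0 < x → 0 < y → σ₁ * y - σ₂ * x = 0 →
      VxE μ δ σ₁ σ₂ x y = VyE μ δ σ₁ σ₂ x y := fun x y hx hy h => line_eq hσ₁ hσ₂ hκ hx hy h
  refine ⟨fun x y hx hy h => main_pos hμ hσ₁ hσ₂ hκ ((line_iff hσ₁).1 h), ?_, ?_, ?_⟩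
  all_goals
    ext ⟨x, y⟩
    simp only [mem_ofPred_eq, mem_prod, mem_Ioi, line_iff hσ₁, line_iff' hσ₁, line_iff_eq hσ₁]
    refine and_congr_right fun ⟨hx, hy⟩ => ?_
    rcases lt_trichotomy (σ₁ * y - σ₂ * x) 0 with h | h | h
  · exact iff_of_false (lo x y h).not_gt h.not_gt
  · exact iff_of_false (eq x y hx hy h).not_gt h.not_gt
  · exact iff_of_true (up x y h) h
  · exact iff_of_true (lo x y h) h
  · exact iff_of_false (eq x y hx hy h).not_lt h.not_lt
  · exact iff_of_false (up x y h).not_gt h.not_gt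
  · exact iff_of_false (lo x y h).ne h.ne
  · exact iff_of_true (eq x y hx hy h) h
  · exact iff_of_false (up x y h).ne' h.ne'
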